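/- Let ρ be a nonnegative function in L¹(ℝ³), let n be a positive integer, let R > 0, and let B_1,…,B_n be open balls in ℝ³, each of radius at most R. If ∫_{∪_{i=1}^n B_i} ρ ≥ δ for some δ > 0, then D(ρ) ≥ δ²/(4n²R). In particular D(ρ) is bounded away from 0 along any sequence of nonnegative L¹ functions satisfying such a uniform overlap condition with fixed δ, n, R. -/

import Mathlib

open MeasureTheory Metric Filter
open scoped ENNReal

/-- The Coulomb energy `D(ρ) = (1/2)∫∫ ρ(x)ρ(y)/|x-y| dx dy`, with value in `[0,∞]`. -/
noncomputable def coulombEnergy (ρ : EuclideanSpace ℝ (Fin 3) → ℝ) : ℝ≥0∞ :=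
  (1/2) * ∫⁻ x, ∫⁻ y, ENNReal.ofReal (ρ x * ρ y / ‖x - y‖)

/-- The mass `m` of `ρ ≥ 0` in a ball of radius at most `R` forces `D(ρ) ≥ m²/(4R)`, since
`|x - y| < 2R` for any two points of the ball. -/
theorem ofReal_sq_setIntegral_ball_le_coulombEnergy {R r : ℝ} (hR : 0 < R) (hr : r ≤ R)
    (c : EuclideanSpace ℝ (Fin 3)) {ρ : EuclideanSpace ℝ (Fin 3) → ℝ}
    (hint : Integrable ρ) (hpos : ∀ x, 0 ≤ ρ x) :
    ENNReal.ofReal ((∫ x in ball c r, ρ x) ^ 2 / (4 * R)) ≤ coulombEnergy ρ := by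
  set m := ∫ x in ball c r, ρ x
  have hm : ENNReal.ofReal m = ∫⁻ x in ball c r, ENNReal.ofReal (ρ x) :=
    ofReal_integral_eq_lintegral_ofReal hint.integrableOn (ae_of_all _ hpos)
  have hm0 : 0 ≤ m := integral_nonneg hpos
  have inner_le : ∀ x ∈ ball c r, ENNReal.ofReal (m / (2 * R)) * ENNReal.ofReal (ρ x) ≤
      ∫⁻ y, ENNReal.ofReal (ρ x * ρ y / ‖x - y‖) := by
    intro x hx
    calc ENNReal.ofReal (m / (2 * R)) * ENNReal.ofReal (ρ x)
        = ENNReal.ofReal (ρ x / (2 * R)) * ENNReal.ofReal m := by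
          rw [← ENNReal.ofReal_mul (by positivity),
            ← ENNReal.ofReal_mul (div_nonneg (hpos x) (by positivity))]
          congr 1
          ring
      _ = ∫⁻ y in ball c r, ENNReal.ofReal (ρ x / (2 * R)) * ENNReal.ofReal (ρ y) := by
          rw [hm, lintegral_const_mul' _ _ ENNReal.ofReal_ne_top]
      _ ≤ ∫⁻ y in ball c r, ENNReal.ofReal (ρ x * ρ y / ‖x - y‖) := by
          refine lintegral_mono_ae ?_
          filter_upwards [ae_restrict_mem measurableSet_ball,
            ae_restrict_of_ae (Measure.ae_ne volume x)] with y hy hyx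
          rw [← ENNReal.ofReal_mul (div_nonneg (hpos x) (by positivity)), div_mul_eq_mul_div]
          refine ENNReal.ofReal_le_ofReal (div_le_div_of_nonneg_left
            (mul_nonneg (hpos x) (hpos y)) (norm_pos_iff.2 (sub_ne_zero.2 hyx.symm)) ?_)
          rw [← dist_eq_norm]
          linarith [dist_triangle_right x y c, mem_ball.1 hx, mem_ball.1 hy]
      _ ≤ ∫⁻ y, ENNReal.ofReal (ρ x * ρ y / ‖x - y‖) := setLIntegral_le_lintegral _ _
  calc ENNReal.ofReal (m ^ 2 / (4 * R))
      = 1 / 2 * (ENNReal.ofReal (m / (2 * R)) * ENNReal.ofReal m) := by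
        have half : (1 / 2 : ℝ≥0∞) = ENNReal.ofReal (1 / 2) := by
          rw [ENNReal.ofReal_div_of_pos two_pos]
          simp
        rw [half, ← ENNReal.ofReal_mul (by positivity), ← ENNReal.ofReal_mul (by positivity)]
        congr 1
        field_simp
        ring
    _ = 1 / 2 * ∫⁻ x in ball c r, ENNReal.ofReal (m / (2 * R)) * ENNReal.ofReal (ρ x) := by
        rw [hm, lintegral_const_mul' _ _ ENNReal.ofReal_ne_top]
    _ ≤ coulombEnergy ρ := by
        refine mul_le_mul' le_rfl ((setLIntegral_mono' measurableSet_ball inner_le).trans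
          (setLIntegral_le_lintegral _ _))

/-- Some set of a finite family carries at least the average share of the mass of the union. -/
theorem exists_div_le_setIntegral_of_le_iUnion {α : Type*} [MeasurableSpace α] {μ : Measure α}
    {n : ℕ} (hn : 0 < n) {s : Fin n → Set α} {f : α → ℝ} {δ : ℝ}
    (hint : Integrable f μ) (hpos : ∀ x, 0 ≤ f x) (h : δ ≤ ∫ x in ⋃ i, s i, f x ∂μ) :
    ∃ i, δ / n ≤ ∫ x in s i, f x ∂μ := by
  have : Nonempty (Fin n) := ⟨⟨0, hn⟩⟩
  have union_le : ∫ x in ⋃ i, s i, f x ∂μ ≤ ∑ i, ∫ x in s i, f x ∂μ := by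
    rw [← integral_finsetSum_measure fun i _ => hint.integrableOn]
    refine integral_mono_measure ?_ (ae_of_all _ hpos)
      (integrable_finsetSum_measure.2 fun i _ => hint.integrableOn)
    rw [← Measure.sum_fintype]
    exact Measure.restrict_iUnion_le
  obtain ⟨i, -, hi⟩ := Finset.exists_le_of_sum_le (s := Finset.univ)
    (f := fun _ : Fin n => δ / n) (g := fun i => ∫ x in s i, f x ∂μ)
    Finset.univ_nonempty (by
      have : (n : ℝ) ≠ 0 := by positivity
      simpa [mul_div_cancel₀, this] using h.trans union_le)
  exact ⟨i, hi⟩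

/-- **Lemma 2.3 (quantitative form).** If a nonnegative `L¹` function `ρ` on `ℝ³` has mass at
least `δ > 0` in a union of `n` open balls of radius at most `R`, then
`D(ρ) ≥ δ²/(4 n² R)`. -/
theorem coulombEnergy_lower_bound_of_mass_in_balls
    (n : ℕ) (hn : 0 < n) (R δ : ℝ) (hR : 0 < R) (hδ : 0 < δ)
    (c : Fin n → EuclideanSpace ℝ (Fin 3)) (r : Fin n → ℝ) (hr : ∀ i, r i ≤ R)
    (ρ : EuclideanSpace ℝ (Fin 3) → ℝ)
    (hint : Integrable ρ) (hpos : ∀ x, 0 ≤ ρ x)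
    (hover : δ ≤ ∫ x in ⋃ i, ball (c i) (r i), ρ x) :
    ENNReal.ofReal (δ ^ 2 / (4 * (n : ℝ) ^ 2 * R)) ≤ coulombEnergy ρ := by
  obtain ⟨i, hi⟩ := exists_div_le_setIntegral_of_le_iUnion hn hint hpos hover
  refine le_trans (ENNReal.ofReal_le_ofReal ?_)
    (ofReal_sq_setIntegral_ball_le_coulombEnergy hR (hr i) (c i) hint hpos)
  calc δ ^ 2 / (4 * (n : ℝ) ^ 2 * R) = (δ / n) ^ 2 / (4 * R) := by field_simp
    _ ≤ (∫ x in ball (c i) (r i), ρ x) ^ 2 / (4 * R) := by gcongr
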